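/- arXiv:2411.18981 — 2 statements merged into one kernel-verified Lean document; each statement's English description precedes it below -/
import Mathlib

section
/- Let F be a field and let f be an n-variate polynomial over F of individual degree at most d, and let σ be a permutation of {1,…,n} and w a positive integer. Then f has an ROABP of width w in the order σ if and only if for every i ∈ {1,…,n−1}, the Nisan matrix of f with respect to the prefix T_i = {σ(1),…,σ(i)} has rank at most w. -/
open MvPolynomial

/-- `f` has individual degree at most `d`: every variable appears with exponent at most `d`
in every monomial of `f`. -/
def IndivDegLE {F : Type*} [CommSemiring F] {V : Type*} (f : MvPolynomial V F) (d : ℕ) : Prop :=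
  ∀ m ∈ f.support, ∀ i : V, m i ≤ d

/-- The Nisan matrix of `f` with respect to the set `T` of variables, where exponents
range over `{0, …, d}`. -/
noncomputable def nisanMatrix {F : Type*} [Field F] {V : Type*} [Fintype V] [DecidableEq V]
    (d : ℕ) (f : MvPolynomial V F) (T : Finset V) :
    Matrix ({x : V // x ∈ T} → Fin (d + 1)) ({x : V // x ∉ T} → Fin (d + 1)) F :=
  Matrix.of fun a b => MvPolynomial.coeff
    (Finsupp.equivFunOnFinite.symm fun i =>
      if h : i ∈ T then (a ⟨i, h⟩ : ℕ) else (b ⟨i, h⟩ : ℕ)) f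

/-- Ordered product `L 0 * L 1 * ⋯ * L (k-1)` of matrices of varying dimensions. -/
def matProdUpTo {R : Type*} [CommSemiring R] (ws : ℕ → ℕ)
    (L : (i : ℕ) → Matrix (Fin (ws i)) (Fin (ws (i + 1))) R) :
    (k : ℕ) → Matrix (Fin (ws 0)) (Fin (ws k)) R
  | 0 => 1
  | k + 1 => matProdUpTo ws L k * L k

/-- `f` has an ROABP of width `w` in the order `σ`: there are widths
`ws 0 = ws n = 1`, `1 ≤ ws i ≤ w` for `0 < i < n`, and coefficient matrices
`A i j ∈ F^{ws i × ws (i+1)}` such that `f` is the `(1,1)` entry of the ordered product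
of the layer matrices `Σ_j A i j • x_{σ(i)}^j`. -/
def HasROABP {F : Type*} [Field F] {n : ℕ} (d : ℕ) (f : MvPolynomial (Fin n) F)
    (σ : Equiv.Perm (Fin n)) (w : ℕ) : Prop :=
  ∃ (ws : ℕ → ℕ) (A : (i : Fin n) → Fin (d + 1) →
      Matrix (Fin (ws i.val)) (Fin (ws (i.val + 1))) F),
    ws 0 = 1 ∧ ws n = 1 ∧ (∀ i : ℕ, 0 < i → i < n → 1 ≤ ws i ∧ ws i ≤ w) ∧
    ∀ (p : Fin (ws 0)) (q : Fin (ws n)),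
      f = matProdUpTo ws
        (fun i => if h : i < n then
            Matrix.of (fun p' q' => ∑ j : Fin (d + 1),
              MvPolynomial.C (A ⟨i, h⟩ j p' q') * MvPolynomial.X (σ ⟨i, h⟩) ^ (j : ℕ))
          else 0) n p q

/-- `T` is a prefix of the order `σ`, i.e. `T = {σ(1), …, σ(i)}` for some `i ∈ {1, …, n}`
(0-indexed: the image under `σ` of the first `i` positions). -/
def IsPrefixOf {n : ℕ} (σ : Equiv.Perm (Fin n)) (T : Finset (Fin n)) : Prop :=
  ∃ i : ℕ, 1 ≤ i ∧ i ≤ n ∧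
    T = (Finset.univ.filter fun l : Fin n => (l : ℕ) < i).image (fun l => σ l)

/-- The `(1,1)` entry of the ordered product of the layer matrices of a width-`w` ROABP
in the order `σ`, with coefficient matrices `A`. -/
noncomputable def roabpPoly {F : Type*} [Field F] {n : ℕ} (d w : ℕ) (hw : 0 < w)
    (σ : Equiv.Perm (Fin n)) (A : Fin n → Fin (d + 1) → Matrix (Fin w) (Fin w) F) :
    MvPolynomial (Fin n) F :=
  (((List.finRange n).map fun i => Matrix.of fun p q =>
      ∑ j : Fin (d + 1), MvPolynomial.C (A i j p q) * MvPolynomial.X (σ i) ^ (j : ℕ)).prod)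
    ⟨0, hw⟩ ⟨0, hw⟩

section Helpers

variable {F : Type*} [Field F]

lemma matProd_congr {R : Type*} [CommSemiring R] (ws : ℕ → ℕ)
    (L L' : (i : ℕ) → Matrix (Fin (ws i)) (Fin (ws (i + 1))) R) (k : ℕ)
    (h : ∀ j < k, L j = L' j) : matProdUpTo ws L k = matProdUpTo ws L' k := by
  induction k with
  | zero => rfl
  | succ k ih =>
    simp only [matProdUpTo]
    rw [ih (fun j hj => h j (by omega)), h k (by omega)]

lemma matProd_zero {R : Type*} [CommSemiring R] (ws : ℕ → ℕ)
    (L : (i : ℕ) → Matrix (Fin (ws i)) (Fin (ws (i + 1))) R) (k j : ℕ) (hj : j < k)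
    (h : L j = 0) : matProdUpTo ws L k = 0 := by
  induction k with
  | zero => omega
  | succ k ih =>
    simp only [matProdUpTo]
    rcases Nat.lt_succ_iff_lt_or_eq.mp hj with h1 | h1
    · rw [ih h1, Matrix.zero_mul]
    · subst h1
      rw [h, Matrix.mul_zero]

lemma matProd_split {R : Type*} [CommSemiring R] (ws : ℕ → ℕ)
    (L : (i : ℕ) → Matrix (Fin (ws i)) (Fin (ws (i + 1))) R) (i k : ℕ) (hik : i ≤ k) :
    ∃ S : Matrix (Fin (ws i)) (Fin (ws k)) R,
      ∀ L' : (i : ℕ) → Matrix (Fin (ws i)) (Fin (ws (i + 1))) R,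
        (∀ j, i ≤ j → L' j = L j) → matProdUpTo ws L' k = matProdUpTo ws L' i * S := by
  induction k, hik using Nat.le_induction with
  | base => exact ⟨1, fun L' _ => (Matrix.mul_one _).symm⟩
  | succ k hk ih =>
    obtain ⟨S, hS⟩ := ih
    refine ⟨S * L k, fun L' h => ?_⟩
    simp only [matProdUpTo]
    rw [hS L' h, h k hk, Matrix.mul_assoc]

/-- Coefficient matrices extended by zero. -/
def extA {n d : ℕ} (ws : ℕ → ℕ) (A : (i : Fin n) → Fin (d + 1) →
      Matrix (Fin (ws i.val)) (Fin (ws (i.val + 1))) F) (σ : Equiv.Perm (Fin n))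
      (m : Fin n → ℕ) (i : ℕ) : Matrix (Fin (ws i)) (Fin (ws (i + 1))) F :=
  if h : i < n then
    (if h' : m (σ ⟨i, h⟩) < d + 1 then A ⟨i, h⟩ ⟨m (σ ⟨i, h⟩), h'⟩ else 0) else 0

lemma extA_congr {n d : ℕ} (ws : ℕ → ℕ) (A : (i : Fin n) → Fin (d + 1) →
      Matrix (Fin (ws i.val)) (Fin (ws (i.val + 1))) F) (σ : Equiv.Perm (Fin n))
      (m m' : Fin n → ℕ) (i : ℕ) (h : ∀ hi : i < n, m (σ ⟨i, hi⟩) = m' (σ ⟨i, hi⟩)) :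
    extA ws A σ m i = extA ws A σ m' i := by
  by_cases hi : i < n
  · simp only [extA, h hi]
  · simp only [extA, dif_neg hi]

lemma coeff_matProd {n d : ℕ} (ws : ℕ → ℕ) (A : (i : Fin n) → Fin (d + 1) →
      Matrix (Fin (ws i.val)) (Fin (ws (i.val + 1))) F) (σ : Equiv.Perm (Fin n))
      (k : ℕ) (hk : k ≤ n) (m : Fin n →₀ ℕ) (p : Fin (ws 0)) (q : Fin (ws k)) :
    MvPolynomial.coeff m (matProdUpTo ws
        (fun i => if h : i < n then
            Matrix.of (fun p' q' => ∑ j : Fin (d + 1),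
              MvPolynomial.C (A ⟨i, h⟩ j p' q') * MvPolynomial.X (σ ⟨i, h⟩) ^ (j : ℕ))
          else 0) k p q) =
      open Classical in
      if ∀ i : Fin n, k ≤ i → m (σ i) = 0 then matProdUpTo ws (extA ws A σ m) k p q else 0 := by
  classical
  induction k generalizing m with
  | zero =>
    simp only [matProdUpTo, Matrix.one_apply]
    by_cases hm : m = 0
    · subst hm
      by_cases hpq : p = q <;> simp [hpq]
    · have : ¬ ∀ i : Fin n, 0 ≤ (i : ℕ) → m (σ i) = 0 := by
        intro h
        apply hm
        ext v
        simpa using h (σ.symm v) (Nat.zero_le _)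
      rw [if_neg this]
      by_cases hpq : p = q
      · simp [hpq, MvPolynomial.coeff_one, Ne.symm hm]
      · simp [hpq]
  | succ k ih =>
    have hkn : k < n := hk
    simp only [matProdUpTo, Matrix.mul_apply]
    rw [dif_pos hkn]
    simp only [Matrix.of_apply, MvPolynomial.coeff_sum, Finset.mul_sum]
    have key : ∀ (r : Fin (ws k)) (j : Fin (d + 1)) (Q : MvPolynomial (Fin n) F),
        MvPolynomial.coeff m (Q * (MvPolynomial.C (A ⟨k, hkn⟩ j r q) *
          MvPolynomial.X (σ ⟨k, hkn⟩) ^ (j : ℕ))) =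
        A ⟨k, hkn⟩ j r q * (if (j : ℕ) ≤ m (σ ⟨k, hkn⟩) then
          MvPolynomial.coeff (m - Finsupp.single (σ ⟨k, hkn⟩) (j : ℕ)) Q else 0) := by
      intro r j Q
      rw [mul_left_comm, MvPolynomial.coeff_C_mul, MvPolynomial.X_pow_eq_monomial,
        MvPolynomial.coeff_mul_monomial']
      simp [Finsupp.single_le_iff]
    simp only [key]
    simp only [ih hkn.le]
    have key2 : ∀ (r : Fin (ws k)) (j : Fin (d + 1)),
        (if (j : ℕ) ≤ m (σ ⟨k, hkn⟩) then
          (if ∀ i : Fin n, k ≤ i → (m - Finsupp.single (σ ⟨k, hkn⟩) (j : ℕ)) (σ i) = 0 then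
            matProdUpTo ws (extA ws A σ (m - Finsupp.single (σ ⟨k, hkn⟩) (j : ℕ))) k p r else 0)
          else 0) =
        if (j : ℕ) = m (σ ⟨k, hkn⟩) then
          (if ∀ i : Fin n, k + 1 ≤ i → m (σ i) = 0 then
            matProdUpTo ws (extA ws A σ m) k p r else 0) else 0 := by
      intro r j
      have hne : ∀ i : Fin n, (i : ℕ) ≠ k →
          (m - Finsupp.single (σ ⟨k, hkn⟩) (j : ℕ)) (σ i) = m (σ i) := by
        intro i hi
        have : σ ⟨k, hkn⟩ ≠ σ i := by
          intro h
          apply hi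
          rw [← σ.injective h]
        simp [this]
      by_cases hj : (j : ℕ) = m (σ ⟨k, hkn⟩)
      · rw [if_pos hj.le, if_pos hj]
        have e1 : (∀ i : Fin n, k ≤ i → (m - Finsupp.single (σ ⟨k, hkn⟩) (j : ℕ)) (σ i) = 0) ↔
            ∀ i : Fin n, k + 1 ≤ i → m (σ i) = 0 := by
          constructor
          · intro h i hi
            rw [← hne i (by omega)]
            exact h i (by omega)
          · intro h i hi
            by_cases hik : (i : ℕ) = k
            · have : i = ⟨k, hkn⟩ := Fin.ext hik
              subst this
              simp [hj]
            · rw [hne i hik]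
              exact h i (by omega)
        simp only [e1]
        congr 1
        refine congrFun (congrFun (matProd_congr ws _ _ k ?_) p) r
        intro i hi
        exact extA_congr ws A σ _ _ i fun hin => hne ⟨i, hin⟩ (by simpa using hi.ne)
      · rw [if_neg hj]
        by_cases hle : (j : ℕ) ≤ m (σ ⟨k, hkn⟩)
        · rw [if_pos hle, if_neg]
          intro h
          have := h ⟨k, hkn⟩ le_rfl
          simp at this
          omega
        · rw [if_neg hle]
    refine Eq.trans (Finset.sum_congr rfl fun r _ => Finset.sum_congr rfl fun j _ =>
      congrArg (A ⟨k, hkn⟩ j r q * ·) (key2 r j)) ?_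
    by_cases hz : ∀ i : Fin n, k + 1 ≤ i → m (σ i) = 0
    · simp only [if_pos hz]
      refine Finset.sum_congr rfl fun r _ => ?_
      by_cases hd : m (σ ⟨k, hkn⟩) < d + 1
      · rw [Finset.sum_eq_single ⟨m (σ ⟨k, hkn⟩), hd⟩]
        · simp [extA, hkn, hd, mul_comm]
        · intro j _ hj
          rw [if_neg, mul_zero]
          intro h
          exact hj (Fin.ext h)
        · simp
      · rw [Finset.sum_eq_zero]
        · simp [extA, hkn, hd]
        · intro j _
          rw [if_neg, mul_zero]
          have := j.2
          omega
    · simp only [if_neg hz]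
      simp

lemma coeff_matProd_full {n d : ℕ} (ws : ℕ → ℕ) (A : (i : Fin n) → Fin (d + 1) →
      Matrix (Fin (ws i.val)) (Fin (ws (i.val + 1))) F) (σ : Equiv.Perm (Fin n))
      (m : Fin n →₀ ℕ) (p : Fin (ws 0)) (q : Fin (ws n)) :
    MvPolynomial.coeff m (matProdUpTo ws
        (fun i => if h : i < n then
            Matrix.of (fun p' q' => ∑ j : Fin (d + 1),
              MvPolynomial.C (A ⟨i, h⟩ j p' q') * MvPolynomial.X (σ ⟨i, h⟩) ^ (j : ℕ))
          else 0) n p q) = matProdUpTo ws (extA ws A σ m) n p q := by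
  classical
  rw [coeff_matProd ws A σ n le_rfl, if_pos]
  intro i hi
  have := i.2
  omega

lemma mem_prefix {n : ℕ} (σ : Equiv.Perm (Fin n)) (i : ℕ) (v : Fin n) :
    v ∈ (Finset.univ.filter fun l : Fin n => (l : ℕ) < i).image (fun l => σ l) ↔
      (σ.symm v : ℕ) < i := by
  simp only [Finset.mem_image, Finset.mem_filter, Finset.mem_univ, true_and]
  constructor
  · rintro ⟨l, hl, rfl⟩
    simpa using hl
  · intro h
    exact ⟨σ.symm v, h, by simp⟩

lemma forward_dir {n d w : ℕ} (f : MvPolynomial (Fin n) F) (σ : Equiv.Perm (Fin n))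
    (H : HasROABP d f σ w) (i : ℕ) (h1 : 1 ≤ i) (h2 : i < n) :
    (nisanMatrix d f
      ((Finset.univ.filter fun l : Fin n => (l : ℕ) < i).image (fun l => σ l))).rank ≤ w := by
  obtain ⟨ws, A, w0, wn, hw, hf⟩ := H
  let p : Fin (ws 0) := ⟨0, by omega⟩
  let q : Fin (ws n) := ⟨0, by omega⟩
  set T := (Finset.univ.filter fun l : Fin n => (l : ℕ) < i).image (fun l => σ l) with hT
  let mm : ({x : Fin n // x ∈ T} → Fin (d + 1)) → ({x : Fin n // x ∉ T} → Fin (d + 1)) →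
      Fin n → ℕ := fun a b v => if h : v ∈ T then (a ⟨v, h⟩ : ℕ) else (b ⟨v, h⟩ : ℕ)
  have hsp := fun b => matProd_split ws (extA ws A σ (mm 0 b)) i n h2.le
  choose S hS using hsp
  have hfac : nisanMatrix d f T =
      (Matrix.of fun a r => matProdUpTo ws (extA ws A σ (mm a 0)) i p r) *
      (Matrix.of fun r b => S b r q) := by
    ext a b
    have e1 : nisanMatrix d f T a b = matProdUpTo ws (extA ws A σ (mm a b)) n p q := by
      have := coeff_matProd_full ws A σ (Finsupp.equivFunOnFinite.symm (mm a b)) p q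
      rw [← hf p q] at this
      exact this
    rw [e1, hS b (extA ws A σ (mm a b))]
    · simp only [Matrix.mul_apply, Matrix.of_apply]
      rw [matProd_congr ws (extA ws A σ (mm a b)) (extA ws A σ (mm a 0)) i]
      intro j hj
      have hjn : j < n := by omega
      have hmem : σ ⟨j, hjn⟩ ∈ T := by
        rw [hT, mem_prefix]
        simpa using hj
      have : mm a b (σ ⟨j, hjn⟩) = mm a 0 (σ ⟨j, hjn⟩) := by
        simp only [mm, dif_pos hmem]
      simp only [extA, this]
    · intro j hj
      by_cases hjn : j < n
      · have hmem : σ ⟨j, hjn⟩ ∉ T := by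
          rw [hT, mem_prefix]
          simpa using hj
        have : mm a b (σ ⟨j, hjn⟩) = mm 0 b (σ ⟨j, hjn⟩) := by
          simp only [mm, dif_neg hmem]
        simp only [extA, this]
      · simp [extA, hjn]
  rw [hfac]
  refine (Matrix.rank_mul_le_left _ _).trans ((Matrix.rank_le_card_width _).trans ?_)
  rw [Fintype.card_fin]
  exact (hw i h1 h2).2

lemma exists_family {V : Type*} [AddCommGroup V] [Module F V] [FiniteDimensional F V]
    (W : Submodule F V) (w : ℕ) (hw : 0 < w) (h : Module.finrank F W ≤ w) :
    ∃ (k : ℕ) (S : Fin k → V), 1 ≤ k ∧ k ≤ w ∧ (∀ r, S r ∈ W) ∧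
      W ≤ Submodule.span F (Set.range S) := by
  by_cases h0 : Module.finrank F W = 0
  · refine ⟨1, fun _ => 0, le_rfl, hw, fun _ => W.zero_mem, ?_⟩
    rw [Submodule.finrank_eq_zero.mp h0]
    exact bot_le
  · let B := Module.finBasis F W
    refine ⟨Module.finrank F W, fun r => (B r : V), by omega, h, fun r => (B r).2, ?_⟩
    intro x hx
    rw [Submodule.mem_span_range_iff_exists_fun]
    refine ⟨fun r => B.repr ⟨x, hx⟩ r, ?_⟩
    have := congrArg Subtype.val (B.sum_repr ⟨x, hx⟩)
    simpa [-Module.Basis.sum_repr] using this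

/-- Take positions `< i` from `e`, and the rest from `b`. -/
def mixE {n d : ℕ} (σ : Equiv.Perm (Fin n)) (i : ℕ) (e b : Fin n → Fin (d + 1)) :
    Fin n → Fin (d + 1) := fun v => if (σ.symm v : ℕ) < i then e v else b v

/-- Coefficient function of a polynomial. -/
noncomputable def cf {n : ℕ} (d : ℕ) (f : MvPolynomial (Fin n) F) (e : Fin n → Fin (d + 1)) : F :=
  MvPolynomial.coeff (Finsupp.equivFunOnFinite.symm fun v => (e v : ℕ)) f

/-- Row space of the Nisan matrix of the prefix of length `i`. -/
noncomputable def rowSp {n : ℕ} (d : ℕ) (f : MvPolynomial (Fin n) F) (σ : Equiv.Perm (Fin n))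
    (i : ℕ) : Submodule F ((Fin n → Fin (d + 1)) → F) :=
  Submodule.span F (Set.range fun e b => cf d f (mixE σ i e b))

lemma finrank_rowSp_le {n d : ℕ} (f : MvPolynomial (Fin n) F) (σ : Equiv.Perm (Fin n)) (i : ℕ) :
    Module.finrank F (rowSp d f σ i) ≤ (nisanMatrix d f
      ((Finset.univ.filter fun l : Fin n => (l : ℕ) < i).image (fun l => σ l))).rank := by
  set T := (Finset.univ.filter fun l : Fin n => (l : ℕ) < i).image (fun l => σ l) with hT
  rw [Matrix.rank_eq_finrank_span_row]
  let φ : (({x : Fin n // x ∉ T} → Fin (d + 1)) → F) →ₗ[F] ((Fin n → Fin (d + 1)) → F) :=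
    LinearMap.funLeft F F (fun b x => b x.1)
  refine le_trans (Submodule.finrank_mono ?_) (Submodule.finrank_map_le φ _)
  rw [rowSp, Submodule.span_le]
  rintro _ ⟨e, rfl⟩
  refine ⟨(nisanMatrix d f T).row (fun x => e x.1), Submodule.subset_span ⟨_, rfl⟩, ?_⟩
  ext b
  simp only [φ, LinearMap.funLeft_apply, Matrix.row, nisanMatrix, Matrix.of_apply, cf]
  congr 2
  ext v
  have := mem_prefix σ i v
  rw [← hT] at this
  by_cases hv : v ∈ T
  · simp [hv, mixE, this.mp hv]
  · simp [hv, mixE, mt this.mpr hv]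

lemma rowSp_step {n d : ℕ} (f : MvPolynomial (Fin n) F) (σ : Equiv.Perm (Fin n)) (i : Fin n)
    (j : Fin (d + 1)) (φ : (Fin n → Fin (d + 1)) → F) (h : φ ∈ rowSp d f σ i) :
    (fun b => φ (Function.update b (σ i) j)) ∈ rowSp d f σ (i + 1) := by
  let D : ((Fin n → Fin (d + 1)) → F) →ₗ[F] ((Fin n → Fin (d + 1)) → F) :=
    LinearMap.funLeft F F (fun b => Function.update b (σ i) j)
  suffices hh : rowSp d f σ i ≤ (rowSp d f σ (i + 1)).comap D from hh h
  rw [rowSp, Submodule.span_le]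
  rintro _ ⟨e, rfl⟩
  refine Submodule.subset_span ⟨Function.update e (σ i) j, ?_⟩
  ext b
  simp only [D, LinearMap.funLeft_apply]
  congr 1
  ext v
  by_cases hv : v = σ i
  · subst hv
    simp [mixE]
  · have : (σ.symm v : ℕ) ≠ i := by
      intro h
      apply hv
      rw [← Fin.ext h]
      simp
    simp only [mixE, Function.update_of_ne hv]
    by_cases h1 : (σ.symm v : ℕ) < i
    · rw [if_pos h1, if_pos (by omega)]
    · rw [if_neg h1, if_neg (by omega)]

lemma backward_dir {n d w : ℕ} (hn : 0 < n) (hw : 0 < w)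
    (f : MvPolynomial (Fin n) F) (hf : IndivDegLE f d) (σ : Equiv.Perm (Fin n))
    (H : ∀ i : ℕ, 1 ≤ i → i ≤ n - 1 →
        (nisanMatrix d f
          ((Finset.univ.filter fun l : Fin n => (l : ℕ) < i).image (fun l => σ l))).rank ≤ w) :
    HasROABP d f σ w := by
  have hex : ∀ i : ℕ, ∃ (k : ℕ) (S : Fin k → ((Fin n → Fin (d + 1)) → F)),
      (i = 0 → k = 1 ∧ ∀ r, S r = cf d f) ∧ (i = n → k = 1 ∧ ∀ r, S r = fun _ => 1) ∧
      (0 < i → i < n → 1 ≤ k ∧ k ≤ w) ∧ (i < n → ∀ r, S r ∈ rowSp d f σ i) ∧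
      (0 < i → i ≤ n → rowSp d f σ i ≤ Submodule.span F (Set.range S)) := by
    intro i
    rcases Nat.eq_zero_or_pos i with h0 | h0
    · subst h0
      refine ⟨1, fun _ => cf d f, by simp, by omega, by omega, fun _ _ => ?_, by omega⟩
      refine Submodule.subset_span ⟨0, ?_⟩
      have : ∀ b, mixE σ 0 (0 : Fin n → Fin (d + 1)) b = b := by
        intro b
        ext v
        simp [mixE]
      simp only [this]
    · rcases lt_or_ge i n with h1 | h1
      · obtain ⟨k, S, a1, a2, a3, a4⟩ := exists_family (rowSp d f σ i) w hw
          ((finrank_rowSp_le f σ i).trans (H i h0 (by omega)))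
        exact ⟨k, S, by omega, by omega, fun _ _ => ⟨a1, a2⟩, fun _ => a3, fun _ _ => a4⟩
      · refine ⟨1, fun _ _ => 1, by omega, by simp, by omega, by omega, fun _ hi => ?_⟩
        have : i = n := by omega
        subst this
        rw [rowSp, Submodule.span_le]
        rintro _ ⟨e, rfl⟩
        have : (fun b => cf d f (mixE σ i e b)) = cf d f e • (fun _ => (1 : F)) := by
          ext b
          have : mixE σ i e b = e := by
            ext v
            simp [mixE]
          simp [this]
        simp only [this]
        exact Submodule.smul_mem _ _ (Submodule.subset_span ⟨0, rfl⟩)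
  choose ws S hS0 hSn hSw hSm hSs using hex
  have hA : ∀ (i : Fin n) (j : Fin (d + 1)) (p : Fin (ws i)), ∃ c : Fin (ws (i + 1)) → F,
      ∑ q, c q • S (i + 1) q = fun b => S i p (Function.update b (σ i) j) := by
    intro i j p
    rw [← Submodule.mem_span_range_iff_exists_fun]
    exact hSs (i + 1) (by omega) i.2 (rowSp_step f σ i j _ (hSm i i.2 p))
  choose A hA using hA
  refine ⟨ws, fun i j => Matrix.of (A i j), (hS0 0 rfl).1, (hSn n rfl).1, hSw, ?_⟩
  intro p q
  ext m
  refine Eq.trans ?_ (coeff_matProd_full ws (fun i j => Matrix.of (A i j)) σ m p q).symm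
  by_cases hm : ∀ v, m v < d + 1
  · let e : Fin n → Fin (d + 1) := fun v => ⟨m v, hm v⟩
    have key : ∀ k, k ≤ n → cf d f e = ∑ s, matProdUpTo ws
        (extA ws (fun i j => Matrix.of (A i j)) σ m) k p s * S k s e := by
      intro k
      induction k with
      | zero =>
        intro _
        simp [matProdUpTo, Matrix.one_apply, (hS0 0 rfl).2]
      | succ k ih =>
        intro hk
        rw [ih (by omega)]
        simp only [matProdUpTo, Matrix.mul_apply, Finset.sum_mul]
        rw [Finset.sum_comm]
        refine Finset.sum_congr rfl fun s _ => ?_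
        have h1 := congrFun (hA ⟨k, hk⟩ (e (σ ⟨k, hk⟩)) s) e
        simp only [Function.update_eq_self] at h1
        rw [← h1, Finset.sum_apply, Finset.mul_sum]
        refine Finset.sum_congr rfl fun t _ => ?_
        have hk' : k < n := hk
        simp [extA, hk', hm, e, mul_assoc]
    have h2 := key n le_rfl
    have hq : ∀ s : Fin (ws n), s = q := by
      have := (hSn n rfl).1
      intro s
      ext
      omega
    rw [Finset.sum_eq_single q (fun s _ hs => absurd (hq s) hs) (by simp)] at h2
    rw [(hSn n rfl).2] at h2
    rw [mul_one] at h2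
    rw [← h2, cf]
    congr 1
    ext v
    simp [e]
  · push Not at hm
    obtain ⟨v, hv⟩ := hm
    rw [matProd_zero ws _ n (σ.symm v) (σ.symm v).2 (by simp [extA]; intro h; omega)]
    simp only [Matrix.zero_apply]
    by_contra hne
    have := hf m (MvPolynomial.mem_support_iff.mpr hne) v
    omega

end Helpers

/-- **Nisan's characterization.** `f` has an ROABP of width `w` in the order `σ` iff the Nisan
matrix of every proper nonempty prefix `{σ(1), …, σ(i)}`, `1 ≤ i ≤ n-1`, has rank at most `w`. -/
theorem roabp_iff_nisan_rank_le {F : Type*} [Field F] {n d w : ℕ} (hn : 0 < n) (hw : 0 < w)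
    (f : MvPolynomial (Fin n) F) (hf : IndivDegLE f d) (σ : Equiv.Perm (Fin n)) :
    HasROABP d f σ w ↔
      ∀ i : ℕ, 1 ≤ i → i ≤ n - 1 →
        (nisanMatrix d f
          ((Finset.univ.filter fun l : Fin n => (l : ℕ) < i).image (fun l => σ l))).rank ≤ w := by
  constructor
  · intro H i h1 h2
    exact forward_dir f σ H i h1 (by omega)
  · exact backward_dir hn hw f hf σ
end

section
/- Let F be a field and let G = (V, E) be a finite simple undirected graph with V = {1,…,n}, n ≥ 2, and maximum degree Δ. For each vertex u, fix an injection n_u from the neighborhood of u into {1,…,Δ}, and define f_G := Σ_{v=1}^n x_v^{Δ+1} + Σ_{{u,v}∈E} x_u^{n_u(v)} · x_v^{n_v(u)}. Then for every permutation σ of {1,…,n} and every positive integer w, the polynomial f_G has an ROABP of width w + 2 in the order σ if and only if the cutwidth of G in the linear arrangement σ is at most w, i.e., max_{1≤i≤n−1} |{e ∈ E : e has exactly one endpoint in {σ(1),…,σ(i)}}| ≤ w. -/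
open MvPolynomial

section Aux

/-- Reordering a sum over unordered pairs. -/
lemma sum_pairs_perm {M : Type*} [AddCommMonoid M] {n : ℕ} (σ : Equiv.Perm (Fin n))
    (h : Fin n → Fin n → M) (hs : ∀ u v, h u v = h v u) :
    ∑ p : Fin n × Fin n, (if p.1 < p.2 then h p.1 p.2 else 0) =
      ∑ p : Fin n × Fin n, (if p.1 < p.2 then h (σ p.1) (σ p.2) else 0) := by
  rw [← Finset.sum_filter, ← Finset.sum_filter]
  symm
  refine Finset.sum_nbij'
    (fun p => if σ p.1 < σ p.2 then (σ p.1, σ p.2) else (σ p.2, σ p.1))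
    (fun p => if σ.symm p.1 < σ.symm p.2 then (σ.symm p.1, σ.symm p.2)
      else (σ.symm p.2, σ.symm p.1)) ?_ ?_ ?_ ?_ ?_
  · rintro ⟨a, b⟩ hab
    simp only [Finset.mem_filter, Finset.mem_univ, true_and] at hab ⊢
    split_ifs with h1
    · exact h1
    · have : σ a ≠ σ b := fun h => hab.ne (σ.injective h)
      exact lt_of_le_of_ne (not_lt.mp h1) this.symm
  · rintro ⟨a, b⟩ hab
    simp only [Finset.mem_filter, Finset.mem_univ, true_and] at hab ⊢
    split_ifs with h1
    · exact h1
    · have : σ.symm a ≠ σ.symm b := fun h => hab.ne (σ.symm.injective h)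
      exact lt_of_le_of_ne (not_lt.mp h1) this.symm
  · rintro ⟨a, b⟩ hab
    simp only [Finset.mem_filter, Finset.mem_univ, true_and] at hab
    by_cases h1 : σ a < σ b
    · simp [h1, hab]
    · simp [h1, hab.not_gt]
  · rintro ⟨a, b⟩ hab
    simp only [Finset.mem_filter, Finset.mem_univ, true_and] at hab
    by_cases h1 : σ.symm a < σ.symm b
    · simp [h1, hab]
    · simp [h1, hab.not_gt]
  · rintro ⟨a, b⟩ hab
    dsimp only
    split_ifs
    · rfl
    · exact hs _ _

/-- Coefficients of a product of polynomials in disjoint sets of variables. -/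
lemma coeff_mul_supported {F V : Type*} [Field F] [DecidableEq V] {s t : Set V} (hst : Disjoint s t)
    {g h : MvPolynomial V F} (hg : g ∈ supported F s) (hh : h ∈ supported F t)
    {a b : V →₀ ℕ} (ha : (a.support : Set V) ⊆ s) (hb : (b.support : Set V) ⊆ t) :
    coeff (a + b) (g * h) = coeff a g * coeff b h := by
  classical
  have key : ∀ {s : Set V} {g : MvPolynomial V F}, g ∈ supported F s → ∀ c, coeff c g ≠ 0 →
      ∀ x, x ∉ s → c x = 0 := by
    intro s g hg c hc x hx
    rw [mem_supported] at hg
    by_contra hne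
    exact hx (hg ((mem_vars_iff_mem_support x).2 ⟨c, mem_support_iff.2 hc, Finsupp.mem_support_iff.2 hne⟩))
  have z : ∀ {s : Set V} {a : V →₀ ℕ}, (a.support : Set V) ⊆ s → ∀ x, x ∉ s → a x = 0 := by
    intro s a ha x hx
    by_contra hne
    exact hx (ha (Finsupp.mem_support_iff.2 hne))
  rw [coeff_mul]
  refine Finset.sum_eq_single (a, b) ?_ ?_
  · rintro ⟨c, e⟩ hce hne
    rw [Finset.HasAntidiagonal.mem_antidiagonal] at hce
    dsimp only at hce ⊢
    by_contra hnz
    have hc := key hg c (left_ne_zero_of_mul hnz)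
    have he := key hh e (right_ne_zero_of_mul hnz)
    have ha := z ha
    have hb := z hb
    apply hne
    have hx : ∀ x, c x = a x ∧ e x = b x := by
      intro x
      have h1 : c x + e x = a x + b x := by
        simpa using congrArg (fun f : V →₀ ℕ => f x) hce
      by_cases hxs : x ∈ s
      · have hxt : x ∉ t := fun hxt => Set.disjoint_left.1 hst hxs hxt
        have := he x hxt
        have := hb x hxt
        omega
      · have := hc x hxs
        have := ha x hxs
        omega
    exact Prod.ext (Finsupp.ext fun x => (hx x).1) (Finsupp.ext fun x => (hx x).2)
  · intro h
    exfalso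
    apply h
    rw [Finset.HasAntidiagonal.mem_antidiagonal]

/-- Left factor lies in the algebra of the first variables. -/
lemma matProd_left {R A : Type*} [CommSemiring R] [CommSemiring A] [Algebra A R]
    (ws : ℕ → ℕ) (L : (i : ℕ) → Matrix (Fin (ws i)) (Fin (ws (i + 1))) R)
    (S : Subalgebra A R) (k : ℕ) (hL : ∀ i < k, ∀ p q, L i p q ∈ S) :
    ∀ p q, matProdUpTo ws L k p q ∈ S := by
  induction k with
  | zero =>
    intro p q
    simp only [matProdUpTo, Matrix.one_apply]
    split_ifs
    · exact S.one_mem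
    · exact S.zero_mem
  | succ k ih =>
    intro p q
    simp only [matProdUpTo, Matrix.mul_apply]
    exact S.sum_mem fun j _ => S.mul_mem (ih (fun i hi => hL i (by omega)) _ _) (hL k (by omega) _ _)

lemma matProd_right {R A : Type*} [CommSemiring R] [CommSemiring A] [Algebra A R]
    (ws : ℕ → ℕ) (L : (i : ℕ) → Matrix (Fin (ws i)) (Fin (ws (i + 1))) R)
    (S : Subalgebra A R) (k m : ℕ) (hkm : k ≤ m) (hL : ∀ i, k ≤ i → ∀ p q, L i p q ∈ S) :
    ∃ N : Matrix (Fin (ws k)) (Fin (ws m)) R,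
      matProdUpTo ws L m = matProdUpTo ws L k * N ∧ ∀ p q, N p q ∈ S := by
  induction m, hkm using Nat.le_induction with
  | base =>
    refine ⟨1, by simp, ?_⟩
    intro p q
    simp only [Matrix.one_apply]
    split_ifs
    · exact S.one_mem
    · exact S.zero_mem
  | succ m hm ih =>
    obtain ⟨N, hN, hS⟩ := ih
    refine ⟨N * L m, by rw [matProdUpTo, hN, Matrix.mul_assoc], ?_⟩
    intro p q
    simp only [Matrix.mul_apply]
    exact S.sum_mem fun j _ => S.mul_mem (hS _ _) (hL m hm _ _)

/-- Rank bound: if `f` has an ROABP, then an identity submatrix of the Nisan matrix has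
size at most the width. -/
lemma roabp_lower {F : Type*} [Field F] {n d : ℕ} {f : MvPolynomial (Fin n) F}
    {σ : Equiv.Perm (Fin n)} {w : ℕ} (hf : HasROABP d f σ w) (i : ℕ) (hi : 0 < i) (hin : i < n)
    {ι : Type*} [Fintype ι] [DecidableEq ι] (r c : ι → (Fin n →₀ ℕ))
    (hr : ∀ a, ((r a).support : Set (Fin n)) ⊆ {x | (σ.symm x : ℕ) < i})
    (hc : ∀ a, ((c a).support : Set (Fin n)) ⊆ {x | i ≤ (σ.symm x : ℕ)})
    (hrc : ∀ a b, coeff (r a + c b) f = if a = b then 1 else 0) :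
    Fintype.card ι ≤ w := by
  obtain ⟨ws, A, h0, hn, hw, hfA⟩ := hf
  refine le_trans ?_ (hw i hi hin).2
  have hfA := hfA ⟨0, by omega⟩ ⟨0, by omega⟩
  set L : (i : ℕ) → Matrix (Fin (ws i)) (Fin (ws (i + 1))) (MvPolynomial (Fin n) F) :=
    (fun i => if h : i < n then
            Matrix.of (fun p' q' => ∑ j : Fin (d + 1),
              MvPolynomial.C (A ⟨i, h⟩ j p' q') * MvPolynomial.X (σ ⟨i, h⟩) ^ (j : ℕ))
          else 0) with hLdef
  have hLmem : ∀ (s : Set (Fin n)) (k : ℕ), (∀ h : k < n, σ ⟨k, h⟩ ∈ s) →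
      ∀ p q, L k p q ∈ supported F s := by
    intro s k hk p q
    rw [hLdef]
    dsimp only
    split_ifs with h
    · simp only [Matrix.of_apply]
      refine Subalgebra.sum_mem _ fun j _ => Subalgebra.mul_mem _ ?_ (Subalgebra.pow_mem _ ?_ _)
      · exact Subalgebra.algebraMap_mem _ _
      · exact X_mem_supported.2 (hk h)
    · exact Subalgebra.zero_mem _
  have hP := matProd_left ws L (supported F {x | (σ.symm x : ℕ) < i}) i
    (fun k hk => hLmem _ k (fun h => by simpa using hk))
  obtain ⟨N, hN, hQ⟩ := matProd_right ws L (supported F {x | i ≤ (σ.symm x : ℕ)}) i n hin.le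
    (fun k hk => hLmem _ k (fun h => by simpa using hk))
  rw [hN, Matrix.mul_apply] at hfA
  have hdisj : Disjoint {x : Fin n | (σ.symm x : ℕ) < i} {x | i ≤ (σ.symm x : ℕ)} := by
    rw [Set.disjoint_left]
    intro x hx hx'
    have h1 : (σ.symm x : ℕ) < i := hx
    have h2 : i ≤ (σ.symm x : ℕ) := hx'
    omega
  let P : Matrix ι (Fin (ws i)) F := Matrix.of fun a k => coeff (r a) (matProdUpTo ws L i ⟨0, by omega⟩ k)
  let Q : Matrix (Fin (ws i)) ι F := Matrix.of fun k b => coeff (c b) (N k ⟨0, by omega⟩)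
  have hPQ : P * Q = 1 := by
    ext a b
    rw [Matrix.mul_apply, Matrix.one_apply, ← hrc a b, hfA, coeff_sum]
    refine Finset.sum_congr rfl fun k _ => ?_
    exact (coeff_mul_supported hdisj (hP _ _) (hQ _ _) (hr a) (hc b)).symm
  have h1 : (P * Q).rank = Fintype.card ι := by rw [hPQ, Matrix.rank_one]
  rw [← h1]
  exact (Matrix.rank_mul_le_left P Q).trans (by simpa using Matrix.rank_le_card_width P)

/-- Building an ROABP from a family of forward polynomials. -/
lemma roabp_build {F : Type*} [Field F] {n d : ℕ} {f : MvPolynomial (Fin n) F}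
    {σ : Equiv.Perm (Fin n)} {w : ℕ} {S : Type*} [DecidableEq S] (St : ℕ → Finset S)
    (g : ℕ → S → MvPolynomial (Fin n) F)
    (cf : Fin n → S → S → F) (ex : Fin n → S → S → ℕ) (hex : ∀ i s t, ex i s t ≤ d)
    (s0 t0 : S) (h0 : St 0 = {s0}) (hn : St n = {t0})
    (hcard : ∀ i, 0 < i → i < n → 1 ≤ (St i).card ∧ (St i).card ≤ w)
    (hg0 : g 0 s0 = 1) (hgn : g n t0 = f)
    (hstep : ∀ (i : Fin n), ∀ t ∈ St (i + 1),
      g (i + 1) t = ∑ s ∈ St i, g i s * (C (cf i s t) * X (σ i) ^ ex i s t)) :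
    HasROABP d f σ w := by
  let e : ∀ i, St i ≃ Fin (St i).card := fun i => (St i).equivFin
  refine ⟨fun i => (St i).card, fun i j => Matrix.of fun p q =>
    if (j : ℕ) = ex i ((e i).symm p) ((e (i + 1)).symm q)
      then cf i ((e i).symm p) ((e (i + 1)).symm q) else 0, by simp [h0], by simp [hn], hcard, ?_⟩
  intro p q
  have key : ∀ k, k ≤ n → ∀ q, matProdUpTo (fun i => (St i).card)
        (fun i => if h : i < n then
            Matrix.of (fun p' q' => ∑ j : Fin (d + 1),
              MvPolynomial.C ((fun i j => Matrix.of fun p q =>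
    if (j : ℕ) = ex i ((e i).symm p) ((e (i + 1)).symm q)
      then cf i ((e i).symm p) ((e (i + 1)).symm q) else 0 :
      (i : Fin n) → Fin (d + 1) →
      Matrix (Fin (St i.val).card) (Fin (St (i.val + 1)).card) F) ⟨i, h⟩ j p' q') *
                MvPolynomial.X (σ ⟨i, h⟩) ^ (j : ℕ))
          else 0) k p q = g k ((e k).symm q) := by
    intro k
    induction k with
    | zero =>
      intro _ q
      have hs : ((e 0).symm q : S) = s0 := by
        have := ((e 0).symm q).2
        exact Finset.mem_singleton.1 (h0.subset this)
      have hpq : p = q := by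
        have hc : (St 0).card = 1 := by simp [h0]
        apply Fin.ext
        have := p.2
        have := q.2
        dsimp only at *
        omega
      rw [hs, hg0, matProdUpTo, hpq, Matrix.one_apply_eq]
    | succ k ih =>
      intro hk q
      rw [matProdUpTo, Matrix.mul_apply, hstep ⟨k, hk⟩ _ ((e (k + 1)).symm q).2,
        ← Finset.sum_coe_sort (St k), ← (e k).symm.sum_comp]
      refine Finset.sum_congr rfl fun j _ => ?_
      rw [ih (by omega)]
      congr 1
      have hk' : k < n := hk
      simp only [dif_pos hk', Matrix.of_apply]
      rw [Finset.sum_eq_single (⟨ex ⟨k, hk⟩ ((e k).symm j) ((e (k + 1)).symm q),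
        Nat.lt_succ_of_le (hex _ _ _)⟩ : Fin (d + 1))]
      · simp
      · intro b _ hb
        rw [if_neg, C_0, zero_mul]
        intro h
        exact hb (Fin.ext h)
      · simp
  rw [key n le_rfl q]
  have hs : ((e n).symm q : S) = t0 := by
    have := ((e n).symm q).2
    exact Finset.mem_singleton.1 (hn.subset this)
  rw [hs, hgn]

/-- The part of `f_G` (in arrangement coordinates) living on the first `i` positions. -/
noncomputable def partPoly (F : Type*) [Field F] {n : ℕ} (D : ℕ) (σ : Equiv.Perm (Fin n))
    (adj : Fin n → Fin n → Prop) [DecidableRel adj] (m : Fin n → Fin n → ℕ) (i : ℕ) :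
    MvPolynomial (Fin n) F :=
  (∑ l : Fin n, if (l : ℕ) < i then X (σ l) ^ (D + 1) else 0) +
    ∑ p : Fin n × Fin n, if p.1 < p.2 ∧ adj p.1 p.2 ∧ (p.2 : ℕ) < i then
      X (σ p.1) ^ (m p.1 p.2) * X (σ p.2) ^ (m p.2 p.1) else 0

lemma partPoly_succ (F : Type*) [Field F] {n : ℕ} (D : ℕ) (σ : Equiv.Perm (Fin n))
    (adj : Fin n → Fin n → Prop) [DecidableRel adj] (m : Fin n → Fin n → ℕ) (i : Fin n) :
    partPoly F D σ adj m (i + 1) = partPoly F D σ adj m i + X (σ i) ^ (D + 1) +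
      ∑ p : Fin n × Fin n, if p.1 < p.2 ∧ adj p.1 p.2 ∧ p.2 = i then
        X (σ p.1) ^ (m p.1 p.2) * X (σ p.2) ^ (m p.2 p.1) else 0 := by
  have h1 : (∑ l : Fin n, if (l : ℕ) < i + 1 then (X (σ l) ^ (D + 1) : MvPolynomial (Fin n) F) else 0)
      = (∑ l : Fin n, if (l : ℕ) < i then X (σ l) ^ (D + 1) else 0) + X (σ i) ^ (D + 1) := by
    have : (X (σ i) ^ (D + 1) : MvPolynomial (Fin n) F)
      = ∑ l : Fin n, if l = i then X (σ l) ^ (D + 1) else 0 := by simp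
    rw [this, ← Finset.sum_add_distrib]
    refine Finset.sum_congr rfl fun l _ => ?_
    have : l = i ↔ (l : ℕ) = i := Fin.ext_iff
    by_cases h : (l : ℕ) < i
    · rw [if_pos (by omega), if_pos h, if_neg (by omega), add_zero]
    · by_cases h' : l = i
      · rw [if_pos (by omega), if_neg h, if_pos h', zero_add]
      · rw [if_neg (by omega), if_neg h, if_neg h', zero_add]
  rw [partPoly, partPoly, h1, add_right_comm, add_assoc, add_assoc, add_assoc]
  congr 1
  rw [← add_assoc, add_right_comm]
  congr 1
  rw [← Finset.sum_add_distrib]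
  refine Finset.sum_congr rfl fun p _ => ?_
  have : p.2 = i ↔ (p.2 : ℕ) = i := Fin.ext_iff
  by_cases hp : p.1 < p.2 ∧ adj p.1 p.2
  · by_cases h : (p.2 : ℕ) < i
    · rw [if_pos ⟨hp.1, hp.2, by omega⟩, if_pos ⟨hp.1, hp.2, h⟩, if_neg, add_zero]
      rintro ⟨-, -, h3⟩
      omega
    · by_cases h' : p.2 = i
      · rw [if_pos ⟨hp.1, hp.2, by omega⟩, if_neg (by tauto), if_pos ⟨hp.1, hp.2, h'⟩, zero_add]
      · rw [if_neg, if_neg (by tauto), if_neg (by tauto), zero_add]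
        rintro ⟨-, -, h3⟩
        omega
  · rw [if_neg (by tauto), if_neg (by tauto), if_neg (by tauto), zero_add]

lemma partPoly_coeff (F : Type*) [Field F] {n : ℕ} (D : ℕ) (σ : Equiv.Perm (Fin n))
    (adj : Fin n → Fin n → Prop) [DecidableRel adj] (m : Fin n → Fin n → ℕ)
    (hm : ∀ u v, u < v → adj u v → 1 ≤ m u v ∧ 1 ≤ m v u)
    (x y : Fin n) (hxy : x < y) (p q : ℕ) :
    coeff (Finsupp.single (σ x) p + Finsupp.single (σ y) q) (partPoly F D σ adj m n) =
      (if p = D + 1 ∧ q = 0 then 1 else 0) + (if p = 0 ∧ q = D + 1 then 1 else 0) +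
        if adj x y ∧ p = m x y ∧ q = m y x then 1 else 0 := by
  have hne : σ x ≠ σ y := fun h => hxy.ne (σ.injective h)
  have ev : ∀ l : Fin n, (Finsupp.single (σ x) p + Finsupp.single (σ y) q) (σ l) =
      if l = x then p else if l = y then q else 0 := by
    intro l
    by_cases h1 : l = x
    · subst h1; simp [hne.symm]
    · by_cases h2 : l = y
      · subst h2; simp [hne, h1]
      · simp [Finsupp.single_apply, h1, h2, Ne.symm h1, Ne.symm h2]
  have ext' : ∀ a : Fin n →₀ ℕ, a = Finsupp.single (σ x) p + Finsupp.single (σ y) q ↔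
      ∀ l, a (σ l) = if l = x then p else if l = y then q else 0 := by
    intro a
    constructor
    · rintro rfl l
      exact ev l
    · intro h
      ext z
      have := h (σ.symm z)
      rw [← ev, σ.apply_symm_apply] at this
      exact this
  rw [partPoly, coeff_add, coeff_sum, coeff_sum]
  congr 1
  · have : ∀ l : Fin n, coeff (Finsupp.single (σ x) p + Finsupp.single (σ y) q)
        (if (l : ℕ) < n then (X (σ l) ^ (D + 1) : MvPolynomial (Fin n) F) else 0) =
        (if l = x then (if p = D + 1 ∧ q = 0 then 1 else 0) else 0) +
        (if l = y then (if p = 0 ∧ q = D + 1 then 1 else 0) else 0) := by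
      intro l
      rw [if_pos l.2, coeff_X_pow]
      have hc : (Finsupp.single (σ l) (D + 1) = Finsupp.single (σ x) p + Finsupp.single (σ y) q) ↔
          (l = x ∧ p = D + 1 ∧ q = 0) ∨ (l = y ∧ p = 0 ∧ q = D + 1) := by
        rw [ext']
        constructor
        · intro h
          have hl := h l
          have hx := h x
          have hy := h y
          simp [Finsupp.single_apply] at hl hx hy
          grind
        · rintro (⟨rfl, rfl, rfl⟩ | ⟨rfl, rfl, rfl⟩) l'
          · simp only [Finsupp.single_apply, σ.injective.eq_iff]
            grind
          · simp only [Finsupp.single_apply, σ.injective.eq_iff]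
            grind
      simp only [hc]
      grind
    rw [Finset.sum_congr rfl fun l _ => this l, Finset.sum_add_distrib]
    simp
  · rw [Finset.sum_eq_single (x, y)]
    · dsimp only
      by_cases ha : adj x y
      · rw [if_pos ⟨hxy, ha, y.2⟩, X_pow_eq_monomial, X_pow_eq_monomial, monomial_mul, coeff_monomial]
        have : (Finsupp.single (σ x) (m x y) + Finsupp.single (σ y) (m y x) =
            Finsupp.single (σ x) p + Finsupp.single (σ y) q) ↔ p = m x y ∧ q = m y x := by
          rw [ext']
          constructor
          · intro h
            have hx := h x
            have hy := h y
            simp [hne, hne.symm, hxy.ne, hxy.ne'] at hx hy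
            omega
          · rintro ⟨rfl, rfl⟩ l
            exact ev l
        simp [this, ha]
      · rw [if_neg (by tauto), if_neg (by tauto), coeff_zero]
    · rintro ⟨u, v⟩ _ huv
      dsimp only
      split_ifs with h
      · rw [X_pow_eq_monomial, X_pow_eq_monomial, monomial_mul, coeff_monomial, if_neg]
        rw [ext']
        intro h'
        have hu := h' u
        have hv := h' v
        obtain ⟨h1, h2⟩ := hm u v h.1 h.2.1
        have hnuv : σ u ≠ σ v := fun h'' => h.1.ne (σ.injective h'')
        simp [hnuv, hnuv.symm] at hu hv
        have : ¬ (u = x ∧ v = y) := fun ⟨e1, e2⟩ => huv (by rw [e1, e2])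
        have := h.1
        grind
      · exact coeff_zero _
    · simp

end Aux

/-- Position form of the theorem. -/
theorem roabp_positions {F : Type*} [Field F] {n D : ℕ} (hn : 2 ≤ n)
    (adj : Fin n → Fin n → Prop) [DecidableRel adj] (hsymm : ∀ u v, adj u v → adj v u)
    (m : Fin n → Fin n → ℕ)
    (hm : ∀ u v, adj u v → 1 ≤ m u v ∧ m u v ≤ D)
    (hinj : ∀ u v v', adj u v → adj u v' → m u v = m u v' → v = v')
    (σ : Equiv.Perm (Fin n)) (w : ℕ) :
    HasROABP (D + 1) (partPoly F D σ adj m n) σ (w + 2) ↔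
      ∀ i : ℕ, 1 ≤ i → i ≤ n - 1 →
        (Finset.univ.filter fun p : Fin n × Fin n =>
          adj p.1 p.2 ∧ (p.1 : ℕ) < i ∧ i ≤ (p.2 : ℕ)).card ≤ w := by
  constructor
  · intro hf i hi hin
    set E := Finset.univ.filter fun p : Fin n × Fin n =>
          adj p.1 p.2 ∧ (p.1 : ℕ) < i ∧ i ≤ (p.2 : ℕ) with hE
    have hEm : ∀ e : E, adj e.1.1 e.1.2 ∧ (e.1.1 : ℕ) < i ∧ i ≤ (e.1.2 : ℕ) := by
      intro e
      exact (Finset.mem_filter.1 e.2).2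
    let a0 : Fin n := ⟨0, by omega⟩
    let b0 : Fin n := ⟨n - 1, by omega⟩
    let rx : Option (Option E) → Fin n × ℕ
      | none => (a0, 0)
      | some none => (a0, D + 1)
      | some (some e) => (e.1.1, m e.1.1 e.1.2)
    let cx : Option (Option E) → Fin n × ℕ
      | none => (b0, D + 1)
      | some none => (b0, 0)
      | some (some e) => (e.1.2, m e.1.2 e.1.1)
    have hrx : ∀ a, ((rx a).1 : ℕ) < i := by
      rintro (_ | _ | e)
      · exact hi
      · exact hi
      · exact (hEm e).2.1
    have hcx : ∀ a, i ≤ ((cx a).1 : ℕ) := by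
      rintro (_ | _ | e)
      · exact hin
      · exact hin
      · exact (hEm e).2.2
    have := roabp_lower hf i hi (by omega) (ι := Option (Option E))
      (fun a => Finsupp.single (σ (rx a).1) (rx a).2)
      (fun a => Finsupp.single (σ (cx a).1) (cx a).2) ?_ ?_ ?_
    · simpa using this
    · intro a z hz
      have hz' := Finsupp.support_single_subset hz
      rw [Finset.mem_singleton] at hz'
      subst hz'
      simpa using hrx a
    · intro a z hz
      have hz' := Finsupp.support_single_subset hz
      rw [Finset.mem_singleton] at hz'
      subst hz'
      simpa using hcx a
    · intro a b
      have hlt : (rx a).1 < (cx b).1 := Fin.lt_def.2 ((hrx a).trans_le (hcx b))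
      rw [partPoly_coeff F D σ adj m (fun u v _ h => ⟨(hm u v h).1, (hm v u (hsymm _ _ h)).1⟩) _ _ hlt]
      rcases a with _ | _ | e <;> rcases b with _ | _ | e'
      · have := hm a0 b0
        simp only [rx, cx]
        grind
      · have := hm a0 b0
        simp only [rx, cx]
        grind
      · have := hm a0 e'.1.2
        have := hm _ _ (hsymm _ _ (hEm e').1)
        simp only [rx, cx]
        grind
      · have := hm a0 b0
        simp only [rx, cx]
        grind
      · have := hm a0 b0
        have := fun h => hm b0 a0 (hsymm _ _ h)
        simp only [rx, cx]
        grind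
      · have := hm a0 e'.1.2
        have := hm _ _ (hsymm _ _ (hEm e').1)
        simp only [rx, cx]
        grind
      · have := fun h => hm b0 e.1.1 (hsymm _ _ h)
        have := hm _ _ (hEm e).1
        simp only [rx, cx]
        grind
      · have := fun h => hm b0 e.1.1 (hsymm _ _ h)
        have := hm _ _ (hEm e).1
        simp only [rx, cx]
        grind
      · have h1 := hm _ _ (hEm e).1
        have h2 := hm _ _ (hsymm _ _ (hEm e').1)
        simp only [rx, cx]
        rw [if_neg (by omega), if_neg (by omega), zero_add, zero_add]
        by_cases hee : e = e'
        · subst hee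
          simp [(hEm e).1]
        · rw [if_neg, if_neg (by simpa using hee)]
          rintro ⟨h3, h4, h5⟩
          apply hee
          have h6 := hinj _ _ _ (hEm e).1 h3 h4
          have h7 := hinj _ _ _ (hsymm _ _ (hEm e').1) (hsymm _ _ h3) h5
          exact Subtype.ext (Prod.ext h7.symm h6)
  · intro hcut
    classical
    let St : ℕ → Finset (Option (Option (Fin n × Fin n))) := fun i => Finset.univ.filter fun s =>
      match s with
      | none => i < n
      | some none => 0 < i
      | some (some p) => adj p.1 p.2 ∧ (p.1 : ℕ) < i ∧ i ≤ (p.2 : ℕ)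
    have hSt : ∀ i s, s ∈ St i ↔ (match s with
      | none => i < n
      | some none => 0 < i
      | some (some p) => adj p.1 p.2 ∧ (p.1 : ℕ) < i ∧ i ≤ (p.2 : ℕ)) := by
      intro i s
      simp only [St, Finset.mem_filter, Finset.mem_univ, true_and]
    refine roabp_build (S := Option (Option (Fin n × Fin n))) St
      (fun i s => match s with
        | none => 1
        | some none => partPoly F D σ adj m i
        | some (some p) => X (σ p.1) ^ m p.1 p.2)
      (fun i s t => match s, t with
        | none, none => 1
        | none, some none => 1
        | some none, some none => 1
        | some (some p), some none => if p.2 = i then 1 else 0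
        | none, some (some p) => if p.1 = i then 1 else 0
        | some (some p), some (some p') => if p = p' then 1 else 0
        | _, _ => 0)
      (fun i s t => match s, t with
        | none, some none => D + 1
        | some (some p), some none => min (m p.2 p.1) D
        | none, some (some p) => min (m p.1 p.2) D
        | _, _ => 0)
      ?_ none (some none) ?_ ?_ ?_ rfl rfl ?_
    · rintro i (_ | _ | p) (_ | _ | p') <;> simp
    · ext s
      rw [hSt]
      rcases s with _ | _ | p
      · simp; omega
      · simp
      · simp
    · ext s
      rw [hSt]
      rcases s with _ | _ | p
      · simp
      · simp; omega
      · simp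
    · intro i hi hin
      have hc := hcut i hi (by omega)
      constructor
      · exact Finset.card_pos.2 ⟨none, (hSt _ _).2 hin⟩
      · have hsub : St i ⊆ insert none (insert (some none)
          ((Finset.univ.filter fun p : Fin n × Fin n =>
            adj p.1 p.2 ∧ (p.1 : ℕ) < i ∧ i ≤ (p.2 : ℕ)).image (fun p => some (some p)))) := by
          intro s hs
          rw [hSt] at hs
          rcases s with _ | _ | p
          · simp
          · simp
          · simpa using hs
        refine (Finset.card_le_card hsub).trans ((Finset.card_insert_le _ _).trans ?_)
        have := Finset.card_insert_le (some none)
          ((Finset.univ.filter fun p : Fin n × Fin n =>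
            adj p.1 p.2 ∧ (p.1 : ℕ) < i ∧ i ≤ (p.2 : ℕ)).image (fun p => some (some p)))
        have := Finset.card_image_le (s := (Finset.univ.filter fun p : Fin n × Fin n =>
            adj p.1 p.2 ∧ (p.1 : ℕ) < i ∧ i ≤ (p.2 : ℕ))) (f := fun p => some (some p))
        omega
    · intro i t ht
      rw [hSt] at ht
      simp only [St]
      rw [Finset.sum_filter, Fintype.sum_option, Fintype.sum_option]
      rcases t with _ | _ | p
      · simp
      · dsimp only
        rw [partPoly_succ]
        have h0 : ∀ inst : Decidable (0 < (i : ℕ)),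
            @ite _ (0 < (i : ℕ)) inst (partPoly F D σ adj m i * (C 1 * X (σ i) ^ 0)) 0
            = partPoly F D σ adj m i := by
          intro inst
          split_ifs with h
          · simp
          · have : (i : ℕ) = 0 := by omega
            simp [this, partPoly]
        rw [h0, if_pos i.2, add_comm (partPoly F D σ adj m i), add_assoc]
        congr 1
        · simp
        · congr 1
          refine Finset.sum_congr rfl fun p _ => ?_
          by_cases h2 : p.2 = i
          · by_cases ha : adj p.1 p.2
            · have : min (m p.2 p.1) D = m p.2 p.1 := min_eq_left (hm _ _ (hsymm _ _ ha)).2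
              by_cases hlt : p.1 < p.2
              · rw [if_pos ⟨hlt, ha, h2⟩, if_pos ⟨ha, by rw [← h2]; exact hlt, by rw [h2]⟩,
                  if_pos h2, this, h2]
                simp
              · rw [if_neg (by tauto), if_neg]
                rintro ⟨-, h3, -⟩
                rw [← h2] at h3
                exact hlt h3
            · rw [if_neg (by tauto), if_neg (by tauto)]
          · rw [if_neg (by tauto), if_neg h2]
            simp
      · dsimp only at ht ⊢
        have hmin : min (m p.1 p.2) D = m p.1 p.2 := min_eq_left (hm _ _ ht.1).2
        rw [if_pos i.2, hmin]
        rw [Finset.sum_eq_single p]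
        · by_cases h1 : p.1 = i
          · have hneg : ¬ (adj p.1 p.2 ∧ (p.1 : ℕ) < i ∧ (i : ℕ) ≤ p.2) := by
              rw [h1]; simp
            rw [if_neg hneg]
            simp [h1]
          · have h1' : (p.1 : ℕ) ≠ i := fun h => h1 (Fin.ext h)
            have hpos : adj p.1 p.2 ∧ (p.1 : ℕ) < i ∧ (i : ℕ) ≤ p.2 :=
              ⟨ht.1, by omega, by omega⟩
            rw [if_pos hpos]
            simp [h1]
        · intro b _ hb
          simp [hb]
        · simp

/-- For a simple graph `G` on `{1, …, n}` with maximum degree `Δ` and injections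
`nb u : Nbr(u) ↪ {1, …, Δ}`, the polynomial
`f_G = Σ_v x_v^{Δ+1} + Σ_{{u,v} ∈ E} x_u^{nb u v} x_v^{nb v u}` has an ROABP of width `w + 2` in
the order `σ` iff the cutwidth of `G` in the linear arrangement `σ` is at most `w`, i.e. every
prefix cut `{σ(1), …, σ(i)}`, `1 ≤ i ≤ n - 1`, is crossed by at most `w` edges. -/
theorem roabp_width_iff_cutwidth {F : Type*} [Field F] {n Δ : ℕ} (hn : 2 ≤ n)
    (G : SimpleGraph (Fin n)) [DecidableRel G.Adj]
    (hdeg : ∀ v, G.degree v ≤ Δ)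
    (nb : Fin n → Fin n → ℕ)
    (hnb_range : ∀ u v, G.Adj u v → 1 ≤ nb u v ∧ nb u v ≤ Δ)
    (hnb_inj : ∀ u v v', G.Adj u v → G.Adj u v' → nb u v = nb u v' → v = v')
    (σ : Equiv.Perm (Fin n)) (w : ℕ) (hw : 0 < w) :
    HasROABP (Δ + 1)
        (((∑ v : Fin n, X v ^ (Δ + 1)) +
          ∑ u : Fin n, ∑ v : Fin n,
            if G.Adj u v ∧ u < v then X u ^ (nb u v) * X v ^ (nb v u) else 0 :
          MvPolynomial (Fin n) F)) σ (w + 2) ↔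
      ∀ i : ℕ, 1 ≤ i → i ≤ n - 1 →
        (Finset.univ.filter fun p : Fin n × Fin n =>
          G.Adj p.1 p.2 ∧ p.1 < p.2 ∧
            ¬(p.1 ∈ (Finset.univ.filter fun l : Fin n => (l : ℕ) < i).image (fun l => σ l) ↔
              p.2 ∈ (Finset.univ.filter fun l : Fin n => (l : ℕ) < i).image (fun l => σ l))).card
          ≤ w := by
  classical
  have hpoly : (((∑ v : Fin n, X v ^ (Δ + 1)) +
          ∑ u : Fin n, ∑ v : Fin n,
            if G.Adj u v ∧ u < v then X u ^ (nb u v) * X v ^ (nb v u) else 0 :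
          MvPolynomial (Fin n) F)) =
      partPoly F Δ σ (fun a b => G.Adj (σ a) (σ b)) (fun a b => nb (σ a) (σ b)) n := by
    rw [partPoly]
    congr 1
    · rw [← Equiv.sum_comp σ]
      exact Finset.sum_congr rfl fun l _ => (if_pos l.2).symm
    · have := sum_pairs_perm σ
        (fun u v => if G.Adj u v then (X u ^ (nb u v) * X v ^ (nb v u) : MvPolynomial (Fin n) F) else 0)
        (fun u v => if_congr (G.adj_comm u v) (mul_comm _ _) rfl)
      rw [← Fintype.sum_prod_type']
      refine Eq.trans (Finset.sum_congr rfl fun p _ => ?_)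
        (this.trans (Finset.sum_congr rfl fun p _ => ?_))
      · rw [← ite_and]
        exact if_congr and_comm rfl rfl
      · rw [← ite_and]
        exact if_congr (by simp) rfl rfl
  rw [hpoly, roabp_positions hn (fun a b => G.Adj (σ a) (σ b)) (fun _ _ h => h.symm)
    (fun a b => nb (σ a) (σ b)) (fun u v h => hnb_range _ _ h)
    (fun u v v' h h' e => σ.injective (hnb_inj _ _ _ h h' e)) σ w]
  refine forall_congr' fun i => forall_congr' fun hi => forall_congr' fun hin => ?_
  rw [Finset.card_filter, Finset.card_filter]
  have hmem : ∀ x : Fin n, x ∈ (Finset.univ.filter fun l : Fin n => (l : ℕ) < i).image (fun l => σ l) ↔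
      (σ.symm x : ℕ) < i := by
    intro x
    simp only [Finset.mem_image, Finset.mem_filter, Finset.mem_univ, true_and]
    constructor
    · rintro ⟨a, ha, rfl⟩
      simpa using ha
    · intro h
      exact ⟨σ.symm x, h, by simp⟩
  have := sum_pairs_perm σ
    (fun u v => if G.Adj u v ∧ ¬ ((σ.symm u : ℕ) < i ↔ (σ.symm v : ℕ) < i) then (1 : ℕ) else 0)
    (fun u v => if_congr (by rw [G.adj_comm]; tauto) rfl rfl)
  have e : (∑ p : Fin n × Fin n, if G.Adj p.1 p.2 ∧ p.1 < p.2 ∧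
            ¬(p.1 ∈ (Finset.univ.filter fun l : Fin n => (l : ℕ) < i).image (fun l => σ l) ↔
              p.2 ∈ (Finset.univ.filter fun l : Fin n => (l : ℕ) < i).image (fun l => σ l))
              then 1 else 0) =
      ∑ p : Fin n × Fin n,
        if G.Adj (σ p.1) (σ p.2) ∧ (p.1 : ℕ) < i ∧ i ≤ (p.2 : ℕ) then 1 else 0 := by
    refine Eq.trans (Finset.sum_congr rfl fun p _ => ?_)
        (this.trans (Finset.sum_congr rfl fun p _ => ?_))
    · rw [← ite_and]
      refine if_congr ?_ rfl rfl
      rw [hmem, hmem]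
      tauto
    · rw [← ite_and]
      refine if_congr ?_ rfl rfl
      simp only [Equiv.symm_apply_apply, Fin.lt_def]
      constructor
      · rintro ⟨h1, h2, h3⟩
        exact ⟨h2, by omega, by omega⟩
      · rintro ⟨h1, h2, h3⟩
        exact ⟨by omega, h1, by omega⟩
  rw [e]
end
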